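/- Let x* minimize g(x) = ‖x − b'‖² + (𝟙ᵀ(x − b'))² over the nonpositive orthant C_d. Then for every index i with b'_i > 0, it holds that x*_i = 0. -/

import Mathlib

open Finset

theorem stmt4 (d : ℕ) (b' xs : Fin d → ℝ)
    (hxs : ∀ i, xs i ≤ 0)
    (hmin : ∀ y : Fin d → ℝ, (∀ i, y i ≤ 0) →
      (∑ i, (xs i - b' i) ^ 2) + (∑ i, (xs i - b' i)) ^ 2
        ≤ (∑ i, (y i - b' i) ^ 2) + (∑ i, (y i - b' i)) ^ 2) :
    ∀ i, 0 < b' i → xs i = 0 := by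
  have key : ∀ (i : Fin d) (t : ℝ), xs i + t ≤ 0 →
      0 ≤ 2 * t * (xs i - b' i) + 2 * t ^ 2 + 2 * t * ∑ j, (xs j - b' j) := by
    intro i t ht
    have h := hmin (fun j => xs j + if j = i then t else 0) (by
      intro j
      by_cases hj : j = i
      · subst hj; simpa using ht
      · simpa [hj] using hxs j)
    have h1 : ∑ j, ((xs j + if j = i then t else 0) - b' j)
        = ∑ j, (xs j - b' j) + t := by
      have : ∀ j, ((xs j + if j = i then t else 0) - b' j)
          = (xs j - b' j) + if j = i then t else 0 := fun j => by ring
      simp only [this, sum_add_distrib]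
      simp
    have h2 : ∑ j, ((xs j + if j = i then t else 0) - b' j) ^ 2
        = ∑ j, (xs j - b' j) ^ 2 + (2 * t * (xs i - b' i) + t ^ 2) := by
      have : ∀ j, ((xs j + if j = i then t else 0) - b' j) ^ 2
          = (xs j - b' j) ^ 2 + if j = i then 2 * t * (xs j - b' j) + t ^ 2 else 0 := by
        intro j
        split_ifs <;> ring
      simp only [this]
      rw [sum_add_distrib]
      simp
    simp only [h1, h2] at h
    nlinarith [h]
  intro i hb
  by_contra hne
  have hlt : xs i < 0 := lt_of_le_of_ne (hxs i) hne
  have hS : 0 < ∑ j, (xs j - b' j) := by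
    have h := key i (-xs i) (by simp)
    by_contra hS
    push Not at hS
    nlinarith [mul_pos (neg_pos.2 hlt) hb, mul_nonneg (neg_pos.2 hlt).le (neg_nonneg.2 hS)]
  obtain ⟨j, -, hj⟩ := exists_lt_of_sum_lt (s := univ) (f := fun _ : Fin d => (0 : ℝ))
    (g := fun j => xs j - b' j) (by simpa using hS)
  have h := key j (-(xs j - b' j)) (by have := hxs j; linarith)
  nlinarith [mul_pos hj hS]
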